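/- arXiv:2207.02273 — 12 statements merged into one kernel-verified Lean document; each statement's English description precedes it below -/
import Mathlib

section
/- Let A be an associative k-algebra and R : A → A a linear map. Equip A ⊕ A with the componentwise (direct product) associative multiplication (a,b)•(a',b') = (a·a', b·b'). Then the subspace Gr(R̂) = { (−R(a)+a, −R(a)−a) : a ∈ A } of A ⊕ A is closed under the multiplication • (i.e. is a subalgebra) if and only if R is a modified Rota-Baxter operator of weight −1, that is, R(a)·R(b) + a·b = R(R(a)·b + a·R(b)) for all a, b ∈ A. -/
/-! STATEMENT 1: The graph `Gr(R̂) = {(-R a + a, -R a - a)}` is closed under the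
componentwise multiplication of `A × A` iff `R` is a modified Rota-Baxter operator
of weight `-1`. -/

variable {k : Type*} [Field k] [CharZero k]
variable {A : Type*} [NonUnitalRing A] [Module k A] [SMulCommClass k A A] [IsScalarTower k A A]

theorem stmt1 (R : A →ₗ[k] A) :
    (∀ x ∈ {p : A × A | ∃ a : A, p = (-R a + a, -R a - a)},
      ∀ y ∈ {p : A × A | ∃ a : A, p = (-R a + a, -R a - a)},
        x * y ∈ {p : A × A | ∃ a : A, p = (-R a + a, -R a - a)}) ↔
    (∀ a b : A, R a * R b + a * b = R (R a * b + a * R b)) := by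
  have two_cancel : ∀ u v : A, u + u = v + v → u = v := by
    intro u v h
    have h2 : (2 : k) • u = (2 : k) • v := by simpa only [two_smul] using h
    exact smul_right_injective A (two_ne_zero : (2 : k) ≠ 0) h2
  constructor
  · intro h a b
    obtain ⟨c, hc⟩ := h _ ⟨a, rfl⟩ _ ⟨b, rfl⟩
    rw [Prod.mk_mul_mk, Prod.mk.injEq] at hc
    obtain ⟨h₁, h₂⟩ := hc
    have hc : -c = R a * b + a * R b := by
      apply two_cancel
      calc -c + -c = (-R c - c) - (-R c + c) := by abel
        _ = _ := by rw [← h₁, ← h₂]; noncomm_ring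
    have hRc : R a * R b + a * b = -R c := by
      apply two_cancel
      calc _ = (-R a + a) * (-R b + b) + (-R a - a) * (-R b - b) := by noncomm_ring
        _ = _ := by rw [h₁, h₂]; abel
    rw [hRc, ← hc, map_neg]
  · rintro h _ ⟨a, rfl⟩ _ ⟨b, rfl⟩
    refine ⟨-(R a * b + a * R b), ?_⟩
    rw [map_neg, ← h, Prod.mk_mul_mk, Prod.mk.injEq]
    constructor <;> noncomm_ring
end

section
/- Let (A, P) be a Rota-Baxter algebra of weight λ over a field k of characteristic 0, and let (M, Q) be a bimodule over it. Then (M, S = λ·id_M + 2Q) is a bimodule over the modified Rota-Baxter algebra (A, R = λ·id_A + 2P) of weight κ = −λ²; that is, for all a ∈ A and u ∈ M: R(a)·S(u) = S(R(a)·u + a·S(u)) − λ²·(a·u) and S(u)·R(a) = S(S(u)·a + u·R(a)) − λ²·(u·a). -/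
/-! STATEMENT 2: If `(M, Q)` is a bimodule over a Rota-Baxter algebra `(A, P)` of weight
`λ`, then `(M, S = λ·id + 2Q)` is a bimodule over the modified Rota-Baxter algebra
`(A, R = λ·id + 2P)` of weight `κ = -λ²`. -/

variable {k : Type*} [Field k] [CharZero k]
variable {A : Type*} [NonUnitalRing A] [Module k A] [SMulCommClass k A A] [IsScalarTower k A A]
variable {M : Type*} [AddCommGroup M] [Module k M]

/-- The map `λ·id + 2P`. -/
def Rof (lam : k) {V : Type*} [AddCommGroup V] [Module k V] (P : V →ₗ[k] V) : V →ₗ[k] V :=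
  lam • LinearMap.id + (2 : k) • P

theorem stmt2 (lam : k) (P : A →ₗ[k] A)
    (hP : ∀ a b : A, P a * P b = P (P a * b + a * P b) + lam • P (a * b))
    -- `M` is an `A`-bimodule via the left action `l` and right action `r`
    (l : A →ₗ[k] M →ₗ[k] M) (r : M →ₗ[k] A →ₗ[k] M)
    (hbl : ∀ (a b : A) (u : M), l (a * b) u = l a (l b u))
    (hblr : ∀ (a : A) (u : M) (b : A), r (l a u) b = l a (r u b))
    (hbr : ∀ (u : M) (a b : A), r (r u a) b = r u (a * b))
    -- `(M, Q)` is a bimodule over the Rota-Baxter algebra `(A, P)`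
    (Q : M →ₗ[k] M)
    (hQ1 : ∀ (a : A) (u : M), l (P a) (Q u) = Q (l (P a) u + l a (Q u)) + lam • Q (l a u))
    (hQ2 : ∀ (a : A) (u : M), r (Q u) (P a) = Q (r (Q u) a + r u (P a)) + lam • Q (r u a)) :
    (∀ (a : A) (u : M),
      l (Rof lam P a) (Rof lam Q u) =
        Rof lam Q (l (Rof lam P a) u + l a (Rof lam Q u)) + (-(lam ^ 2)) • l a u) ∧
    (∀ (a : A) (u : M),
      r (Rof lam Q u) (Rof lam P a) =
        Rof lam Q (r (Rof lam Q u) a + r u (Rof lam P a)) + (-(lam ^ 2)) • r u a) := by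
  constructor
  · intro a u
    have h := hQ1 a u
    simp only [Rof, LinearMap.add_apply, LinearMap.smul_apply, LinearMap.id_apply, map_add,
      map_smul, smul_add] at h ⊢
    linear_combination (norm := module) (4 : k) • h
  · intro a u
    have h := hQ2 a u
    simp only [Rof, LinearMap.add_apply, LinearMap.smul_apply, LinearMap.id_apply, map_add,
      map_smul, smul_add] at h ⊢
    linear_combination (norm := module) (4 : k) • h
end

section
/- Let (A, R) be a modified Rota-Baxter algebra of weight κ over a field k of characteristic 0, and let (M, S) be a bimodule over it. Equip End(M) (the space of k-linear endomorphisms of M) with the A-bimodule structure (a ⊙ f)(u) = f(u·a) and (f ⊙ a)(u) = f(a·u). Define S̃ : End(M) → End(M) by S̃(f) = −f ∘ S. Then (End(M), S̃) is a bimodule over (A, R); in particular, for all a ∈ A and f ∈ End(M): R(a) ⊙ S̃(f) = S̃(R(a) ⊙ f + a ⊙ S̃(f)) + κ·(a ⊙ f) and S̃(f) ⊙ R(a) = S̃(S̃(f) ⊙ a + f ⊙ R(a)) + κ·(f ⊙ a). -/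
/-! STATEMENT 4: If `(M, S)` is a bimodule over a modified Rota-Baxter algebra `(A, R)`
of weight `κ`, then `(End(M), S̃)` with `(a ⊙ f)(u) = f(u·a)`, `(f ⊙ a)(u) = f(a·u)` and
`S̃(f) = -f ∘ S` is again a bimodule over `(A, R)`. -/

variable {k : Type*} [Field k] [CharZero k]
variable {A : Type*} [NonUnitalRing A] [Module k A] [SMulCommClass k A A] [IsScalarTower k A A]
variable {M : Type*} [AddCommGroup M] [Module k M]

/-- The left `A`-action on `End(M)`: `(a ⊙ f)(u) = f(u·a)`. -/
def odotL {k A M : Type*} [Field k] [NonUnitalRing A] [Module k A] [AddCommGroup M] [Module k M]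
    (r : M →ₗ[k] A →ₗ[k] M) (a : A) (f : M →ₗ[k] M) : M →ₗ[k] M :=
  f ∘ₗ r.flip a

/-- The right `A`-action on `End(M)`: `(f ⊙ a)(u) = f(a·u)`. -/
def odotR {k A M : Type*} [Field k] [NonUnitalRing A] [Module k A] [AddCommGroup M] [Module k M]
    (l : A →ₗ[k] M →ₗ[k] M) (f : M →ₗ[k] M) (a : A) : M →ₗ[k] M :=
  f ∘ₗ l a

/-- The operator `S̃(f) = -f ∘ S` on `End(M)`. -/
def sTilde {k M : Type*} [Field k] [AddCommGroup M] [Module k M]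
    (S : M →ₗ[k] M) (f : M →ₗ[k] M) : M →ₗ[k] M :=
  -(f ∘ₗ S)

theorem stmt4 (kappa : k) (R : A →ₗ[k] A)
    (hR : ∀ a b : A, R a * R b = R (R a * b + a * R b) + kappa • (a * b))
    (l : A →ₗ[k] M →ₗ[k] M) (r : M →ₗ[k] A →ₗ[k] M)
    (hbl : ∀ (a b : A) (u : M), l (a * b) u = l a (l b u))
    (hblr : ∀ (a : A) (u : M) (b : A), r (l a u) b = l a (r u b))
    (hbr : ∀ (u : M) (a b : A), r (r u a) b = r u (a * b))
    (S : M →ₗ[k] M)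
    (hS1 : ∀ (a : A) (u : M), l (R a) (S u) = S (l (R a) u + l a (S u)) + kappa • l a u)
    (hS2 : ∀ (a : A) (u : M), r (S u) (R a) = S (r (S u) a + r u (R a)) + kappa • r u a) :
    (∀ (a : A) (f : M →ₗ[k] M),
      odotL r (R a) (sTilde S f)
        = sTilde S (odotL r (R a) f + odotL r a (sTilde S f)) + kappa • odotL r a f) ∧
    (∀ (a : A) (f : M →ₗ[k] M),
      odotR l (sTilde S f) (R a)
        = sTilde S (odotR l (sTilde S f) a + odotR l f (R a)) + kappa • odotR l f a) := by
  refine ⟨fun a f => ?_, fun a f => ?_⟩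
  · ext u
    have h := congrArg f (hS2 a u)
    simp only [map_add, map_smul] at h
    simp only [odotL, sTilde, LinearMap.comp_apply, LinearMap.neg_apply, LinearMap.add_apply,
      LinearMap.smul_apply, LinearMap.flip_apply, h]
    abel
  · ext u
    have h := congrArg f (hS1 a u)
    simp only [map_add, map_smul] at h
    simp only [odotR, sTilde, LinearMap.comp_apply, LinearMap.neg_apply, LinearMap.add_apply,
      LinearMap.smul_apply, h]
    abel
end

section
/- Let (A, R) be a modified Rota-Baxter algebra of weight κ over a field k of characteristic 0, and let (M, S) be a bimodule over it. Equip A ⊕ M with the semidirect product associative multiplication (a,u)·(b,v) = (a·b, a·v + u·b). Then the linear map R ⊕ S : A ⊕ M → A ⊕ M, (a,u) ↦ (R(a), S(u)), is a modified Rota-Baxter operator of weight κ on this algebra; i.e. (A ⊕ M, R ⊕ S) is a modified Rota-Baxter algebra of weight κ. -/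
/-! STATEMENT 5: The semidirect product `(A ⊕ M, R ⊕ S)` of a modified Rota-Baxter
algebra `(A, R)` of weight `κ` and a bimodule `(M, S)` is a modified Rota-Baxter
algebra of weight `κ`. -/

variable {k : Type*} [Field k] [CharZero k]
variable {A : Type*} [NonUnitalRing A] [Module k A] [SMulCommClass k A A] [IsScalarTower k A A]
variable {M : Type*} [AddCommGroup M] [Module k M]

/-- The semidirect product multiplication on `A ⊕ M`. -/
def sdMul {k A M : Type*} [Field k] [NonUnitalRing A] [Module k A] [AddCommGroup M] [Module k M]
    (l : A →ₗ[k] M →ₗ[k] M) (r : M →ₗ[k] A →ₗ[k] M) (p q : A × M) : A × M :=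
  (p.1 * q.1, l p.1 q.2 + r p.2 q.1)

/-- The map `R ⊕ S` on `A ⊕ M`. -/
def sdRS {k A M : Type*} [Field k] [NonUnitalRing A] [Module k A] [AddCommGroup M] [Module k M]
    (R : A →ₗ[k] A) (S : M →ₗ[k] M) (p : A × M) : A × M :=
  (R p.1, S p.2)

theorem stmt5 (kappa : k) (R : A →ₗ[k] A)
    (hR : ∀ a b : A, R a * R b = R (R a * b + a * R b) + kappa • (a * b))
    (l : A →ₗ[k] M →ₗ[k] M) (r : M →ₗ[k] A →ₗ[k] M)
    (hbl : ∀ (a b : A) (u : M), l (a * b) u = l a (l b u))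
    (hblr : ∀ (a : A) (u : M) (b : A), r (l a u) b = l a (r u b))
    (hbr : ∀ (u : M) (a b : A), r (r u a) b = r u (a * b))
    (S : M →ₗ[k] M)
    (hS1 : ∀ (a : A) (u : M), l (R a) (S u) = S (l (R a) u + l a (S u)) + kappa • l a u)
    (hS2 : ∀ (a : A) (u : M), r (S u) (R a) = S (r (S u) a + r u (R a)) + kappa • r u a) :
    ∀ p q : A × M,
      sdMul l r (sdRS R S p) (sdRS R S q) =
        sdRS R S (sdMul l r (sdRS R S p) q + sdMul l r p (sdRS R S q))
          + kappa • sdMul l r p q := by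
  rintro ⟨a, u⟩ ⟨b, v⟩
  refine Prod.ext (hR a b) ?_
  simp only [sdMul, sdRS, Prod.snd_add, Prod.smul_snd, Prod.mk_add_mk, hS1, hS2, map_add,
    smul_add]
  abel
end

section
/- Let (A, R) be a modified Rota-Baxter algebra of weight κ over a field k of characteristic 0, and let A_R denote A with the associative product a ∗_R b = R(a)·b + a·R(b). Then R is a modified Rota-Baxter operator of weight κ on A_R; i.e. R(a) ∗_R R(b) = R(R(a) ∗_R b + a ∗_R R(b)) + κ·(a ∗_R b) for all a, b ∈ A. -/
/-! STATEMENT 7: For a modified Rota-Baxter algebra `(A, R)` of weight `κ`, the map `R`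
is a modified Rota-Baxter operator of weight `κ` on `A_R = (A, ∗_R)`. -/

variable {k : Type*} [Field k] [CharZero k]
variable {A : Type*} [NonUnitalRing A] [Module k A] [SMulCommClass k A A] [IsScalarTower k A A]

/-- The product `a ∗_R b = R(a)·b + a·R(b)`. -/
def starR {k A : Type*} [Field k] [NonUnitalRing A] [Module k A]
    (R : A →ₗ[k] A) (a b : A) : A :=
  R a * b + a * R b

theorem stmt7 (kappa : k) (R : A →ₗ[k] A)
    (hR : ∀ a b : A, R a * R b = R (R a * b + a * R b) + kappa • (a * b)) :
    ∀ a b : A,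
      starR R (R a) (R b) = R (starR R (R a) b + starR R a (R b)) + kappa • starR R a b := by
  intro a b
  simp only [starR, map_add, smul_add] at hR ⊢
  rw [hR (R a) b, hR a (R b)]
  abel
end

section
/- Let (A, R) be a modified Rota-Baxter algebra of weight κ over a field k of characteristic 0, and let (M, S) be a bimodule over it. Define left and right actions of A_R on M by a ·_S u = R(a)·u + a·S(u) and u ·_S a = S(u)·a + u·R(a). Then these actions make M an A_R-bimodule, i.e. for all a, b ∈ A and u ∈ M: (a ∗_R b) ·_S u = a ·_S (b ·_S u), (a ·_S u) ·_S b = a ·_S (u ·_S b), and (u ·_S a) ·_S b = u ·_S (a ∗_R b). -/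
/-! STATEMENT 8: Given a bimodule `(M, S)` over a modified Rota-Baxter algebra `(A, R)`
of weight `κ`, the actions `a ·_S u = R(a)·u + a·S(u)` and `u ·_S a = S(u)·a + u·R(a)`
make `M` an `A_R`-bimodule. -/

variable {k : Type*} [Field k] [CharZero k]
variable {A : Type*} [NonUnitalRing A] [Module k A] [SMulCommClass k A A] [IsScalarTower k A A]
variable {M : Type*} [AddCommGroup M] [Module k M]

/-- The left action `a ·_S u = R(a)·u + a·S(u)`. -/
def lS {k A M : Type*} [Field k] [NonUnitalRing A] [Module k A] [AddCommGroup M] [Module k M]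
    (l : A →ₗ[k] M →ₗ[k] M) (R : A →ₗ[k] A) (S : M →ₗ[k] M) (a : A) (u : M) : M :=
  l (R a) u + l a (S u)

/-- The right action `u ·_S a = S(u)·a + u·R(a)`. -/
def rS {k A M : Type*} [Field k] [NonUnitalRing A] [Module k A] [AddCommGroup M] [Module k M]
    (r : M →ₗ[k] A →ₗ[k] M) (R : A →ₗ[k] A) (S : M →ₗ[k] M) (u : M) (a : A) : M :=
  r (S u) a + r u (R a)

theorem stmt8 (kappa : k) (R : A →ₗ[k] A)
    (hR : ∀ a b : A, R a * R b = R (R a * b + a * R b) + kappa • (a * b))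
    (l : A →ₗ[k] M →ₗ[k] M) (r : M →ₗ[k] A →ₗ[k] M)
    (hbl : ∀ (a b : A) (u : M), l (a * b) u = l a (l b u))
    (hblr : ∀ (a : A) (u : M) (b : A), r (l a u) b = l a (r u b))
    (hbr : ∀ (u : M) (a b : A), r (r u a) b = r u (a * b))
    (S : M →ₗ[k] M)
    (hS1 : ∀ (a : A) (u : M), l (R a) (S u) = S (l (R a) u + l a (S u)) + kappa • l a u)
    (hS2 : ∀ (a : A) (u : M), r (S u) (R a) = S (r (S u) a + r u (R a)) + kappa • r u a) :
    (∀ (a b : A) (u : M), lS l R S (starR R a b) u = lS l R S a (lS l R S b u)) ∧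
    (∀ (a : A) (u : M) (b : A), rS r R S (lS l R S a u) b = lS l R S a (rS r R S u b)) ∧
    (∀ (u : M) (a b : A), rS r R S (rS r R S u a) b = rS r R S u (starR R a b)) := by
  have hR' (a b : A) : R (R a * b + a * R b) = R a * R b - kappa • (a * b) :=
    eq_sub_of_add_eq (hR a b).symm
  have hSl (a : A) (u : M) : S (l (R a) u + l a (S u)) = l (R a) (S u) - kappa • l a u :=
    eq_sub_of_add_eq (hS1 a u).symm
  have hSr (a : A) (u : M) : S (r (S u) a + r u (R a)) = r (S u) (R a) - kappa • r u a :=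
    eq_sub_of_add_eq (hS2 a u).symm
  refine ⟨fun a b u => ?_, fun a u b => ?_, fun u a b => ?_⟩ <;>
  · simp only [lS, rS, starR, hR', hSl, hSr]
    simp only [map_add, map_sub, map_smul, LinearMap.add_apply, LinearMap.sub_apply,
      LinearMap.smul_apply, hbl, hblr, hbr]
    abel
end

section
/- Let (A, R) be a modified Rota-Baxter algebra of weight κ over a field k of characteristic 0, and let (M, S) be a bimodule over it. Let M_S denote the A_R-bimodule M with actions a ·_S u = R(a)·u + a·S(u) and u ·_S a = S(u)·a + u·R(a). Then (M_S, S) is a bimodule over the modified Rota-Baxter algebra (A_R, R) of weight κ; i.e. for all a ∈ A and u ∈ M: R(a) ·_S S(u) = S(R(a) ·_S u + a ·_S S(u)) + κ·(a ·_S u) and S(u) ·_S R(a) = S(S(u) ·_S a + u ·_S R(a)) + κ·(u ·_S a). -/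
/-! STATEMENT 9: Given a bimodule `(M, S)` over a modified Rota-Baxter algebra `(A, R)`
of weight `κ`, the pair `(M_S, S)` is a bimodule over the modified Rota-Baxter algebra
`(A_R, R)` of weight `κ`. -/

variable {k : Type*} [Field k] [CharZero k]
variable {A : Type*} [NonUnitalRing A] [Module k A] [SMulCommClass k A A] [IsScalarTower k A A]
variable {M : Type*} [AddCommGroup M] [Module k M]

theorem stmt9 (kappa : k) (R : A →ₗ[k] A)
    (hR : ∀ a b : A, R a * R b = R (R a * b + a * R b) + kappa • (a * b))
    (l : A →ₗ[k] M →ₗ[k] M) (r : M →ₗ[k] A →ₗ[k] M)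
    (hbl : ∀ (a b : A) (u : M), l (a * b) u = l a (l b u))
    (hblr : ∀ (a : A) (u : M) (b : A), r (l a u) b = l a (r u b))
    (hbr : ∀ (u : M) (a b : A), r (r u a) b = r u (a * b))
    (S : M →ₗ[k] M)
    (hS1 : ∀ (a : A) (u : M), l (R a) (S u) = S (l (R a) u + l a (S u)) + kappa • l a u)
    (hS2 : ∀ (a : A) (u : M), r (S u) (R a) = S (r (S u) a + r u (R a)) + kappa • r u a) :
    (∀ (a : A) (u : M),
      lS l R S (R a) (S u) = S (lS l R S (R a) u + lS l R S a (S u)) + kappa • lS l R S a u) ∧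
    (∀ (a : A) (u : M),
      rS r R S (S u) (R a) = S (rS r R S (S u) a + rS r R S u (R a)) + kappa • rS r R S u a) := by
  constructor
  · intro a u
    simp only [lS]
    rw [hS1 (R a) u, hS1 a (S u)]
    simp only [map_add, smul_add]
    abel
  · intro a u
    simp only [rS]
    rw [hS2 (R a) u, hS2 a (S u)]
    simp only [map_add, smul_add]
    abel
end

section
/- Let (A, R) be a modified Rota-Baxter algebra of weight κ over a field k of characteristic 0, and let (M, S) be a bimodule over it. Define left and right actions of A_R on M by a ~· u = R(a)·u − S(a·u) and u ~· a = u·R(a) − S(u·a). Then these actions make M an A_R-bimodule, i.e. for all a, b ∈ A and u ∈ M: (a ∗_R b) ~· u = a ~· (b ~· u), (a ~· u) ~· b = a ~· (u ~· b), and (u ~· a) ~· b = u ~· (a ∗_R b). -/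
/-! STATEMENT 10: Given a bimodule `(M, S)` over a modified Rota-Baxter algebra `(A, R)`
of weight `κ`, the actions `a ~· u = R(a)·u − S(a·u)` and `u ~· a = u·R(a) − S(u·a)`
make `M` an `A_R`-bimodule. -/

variable {k : Type*} [Field k] [CharZero k]
variable {A : Type*} [NonUnitalRing A] [Module k A] [SMulCommClass k A A] [IsScalarTower k A A]
variable {M : Type*} [AddCommGroup M] [Module k M]

/-- The left action `a ~· u = R(a)·u − S(a·u)`. -/
def lT {k A M : Type*} [Field k] [NonUnitalRing A] [Module k A] [AddCommGroup M] [Module k M]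
    (l : A →ₗ[k] M →ₗ[k] M) (R : A →ₗ[k] A) (S : M →ₗ[k] M) (a : A) (u : M) : M :=
  l (R a) u - S (l a u)

/-- The right action `u ~· a = u·R(a) − S(u·a)`. -/
def rT {k A M : Type*} [Field k] [NonUnitalRing A] [Module k A] [AddCommGroup M] [Module k M]
    (r : M →ₗ[k] A →ₗ[k] M) (R : A →ₗ[k] A) (S : M →ₗ[k] M) (u : M) (a : A) : M :=
  r u (R a) - S (r u a)

theorem stmt10 (kappa : k) (R : A →ₗ[k] A)
    (hR : ∀ a b : A, R a * R b = R (R a * b + a * R b) + kappa • (a * b))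
    (l : A →ₗ[k] M →ₗ[k] M) (r : M →ₗ[k] A →ₗ[k] M)
    (hbl : ∀ (a b : A) (u : M), l (a * b) u = l a (l b u))
    (hblr : ∀ (a : A) (u : M) (b : A), r (l a u) b = l a (r u b))
    (hbr : ∀ (u : M) (a b : A), r (r u a) b = r u (a * b))
    (S : M →ₗ[k] M)
    (hS1 : ∀ (a : A) (u : M), l (R a) (S u) = S (l (R a) u + l a (S u)) + kappa • l a u)
    (hS2 : ∀ (a : A) (u : M), r (S u) (R a) = S (r (S u) a + r u (R a)) + kappa • r u a) :
    (∀ (a b : A) (u : M), lT l R S (starR R a b) u = lT l R S a (lT l R S b u)) ∧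
    (∀ (a : A) (u : M) (b : A), rT r R S (lT l R S a u) b = lT l R S a (rT r R S u b)) ∧
    (∀ (u : M) (a b : A), rT r R S (rT r R S u a) b = rT r R S u (starR R a b)) := by
  refine ⟨fun a b u => ?_, fun a u b => ?_, fun u a b => ?_⟩
  · have h := hS1 a (l b u)
    have hab : R (R a * b + a * R b) = R a * R b - kappa • (a * b) :=
      eq_sub_of_add_eq (hR a b).symm
    simp only [lT, starR, hab, map_add, map_sub, map_smul, LinearMap.add_apply,
      LinearMap.sub_apply, LinearMap.smul_apply, hbl] at h ⊢
    rw [h]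
    abel
  · have h₁ := hS1 a (r u b)
    have h₂ := hS2 b (l a u)
    simp only [lT, rT, map_add, map_sub, LinearMap.sub_apply, hblr] at h₁ h₂ ⊢
    rw [h₁, h₂]
    abel
  · have h := hS2 b (r u a)
    have hab : R (R a * b + a * R b) = R a * R b - kappa • (a * b) :=
      eq_sub_of_add_eq (hR a b).symm
    simp only [rT, starR, hab, map_add, map_sub, map_smul, LinearMap.sub_apply, hbr] at h ⊢
    rw [h]
    abel
end

section
/- Let (A, R) be a modified Rota-Baxter algebra of weight κ over a field k of characteristic 0, and let (M, S) be a bimodule over it. Let M̃ denote the A_R-bimodule M with actions a ~· u = R(a)·u − S(a·u) and u ~· a = u·R(a) − S(u·a). Then (M̃, S) is a bimodule over the modified Rota-Baxter algebra (A_R, R) of weight κ; i.e. for all a ∈ A and u ∈ M: R(a) ~· S(u) = S(R(a) ~· u + a ~· S(u)) + κ·(a ~· u) and S(u) ~· R(a) = S(S(u) ~· a + u ~· R(a)) + κ·(u ~· a). -/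
/-! STATEMENT 11: Given a bimodule `(M, S)` over a modified Rota-Baxter algebra `(A, R)`
of weight `κ`, the pair `(M̃, S)` is a bimodule over the modified Rota-Baxter algebra
`(A_R, R)` of weight `κ`. -/

variable {k : Type*} [Field k] [CharZero k]
variable {A : Type*} [NonUnitalRing A] [Module k A] [SMulCommClass k A A] [IsScalarTower k A A]
variable {M : Type*} [AddCommGroup M] [Module k M]

theorem stmt11 (kappa : k) (R : A →ₗ[k] A)
    (hR : ∀ a b : A, R a * R b = R (R a * b + a * R b) + kappa • (a * b))
    (l : A →ₗ[k] M →ₗ[k] M) (r : M →ₗ[k] A →ₗ[k] M)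
    (hbl : ∀ (a b : A) (u : M), l (a * b) u = l a (l b u))
    (hblr : ∀ (a : A) (u : M) (b : A), r (l a u) b = l a (r u b))
    (hbr : ∀ (u : M) (a b : A), r (r u a) b = r u (a * b))
    (S : M →ₗ[k] M)
    (hS1 : ∀ (a : A) (u : M), l (R a) (S u) = S (l (R a) u + l a (S u)) + kappa • l a u)
    (hS2 : ∀ (a : A) (u : M), r (S u) (R a) = S (r (S u) a + r u (R a)) + kappa • r u a) :
    (∀ (a : A) (u : M),
      lT l R S (R a) (S u) = S (lT l R S (R a) u + lT l R S a (S u)) + kappa • lT l R S a u) ∧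
    (∀ (a : A) (u : M),
      rT r R S (S u) (R a) = S (rT r R S (S u) a + rT r R S u (R a)) + kappa • rT r R S u a) := by
  refine ⟨fun a u => ?_, fun a u => ?_⟩
  · simp only [lT]
    rw [hS1 (R a) u, hS1 a u]
    simp only [map_add, map_sub, map_smul, smul_sub]
    abel
  · simp only [rT]
    rw [hS2 (R a) u, hS2 a u]
    simp only [map_add, map_sub, map_smul, smul_sub]
    abel
end

section
/- Let (A, R) be a modified Rota-Baxter algebra of weight κ over a field k of characteristic 0. Let (μᵢ, Rᵢ) and (μᵢ', Rᵢ') be two formal one-parameter deformations of (A, R) (so μ₀ = μ₀' = μ, R₀ = R₀' = R), and suppose they are equivalent via φ_t = Σ φᵢ tⁱ with φ₀ = id_A, i.e. for every n ≥ 0 and all a, b ∈ A: Σ_{i+j=n} φᵢ(μⱼ(a,b)) = Σ_{i+j+k=n} μᵢ'(φⱼ(a), φ_k(b)) and Σ_{i+j=n} φᵢ ∘ Rⱼ = Σ_{i+j=n} Rᵢ' ∘ φⱼ. Then μ₁(a,b) − μ₁'(a,b) = φ₁(a)·b + a·φ₁(b) − φ₁(a·b) for all a, b ∈ A, and R₁(a)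 − R₁'(a) = R(φ₁(a)) − φ₁(R(a)) for all a ∈ A; i.e. the two infinitesimals differ by the coboundary δ_mRBA(φ₁, 0). -/
/-! STATEMENT 14: The infinitesimals of equivalent formal one-parameter deformations of a
modified Rota-Baxter algebra `(A, R)` of weight `κ` differ by the coboundary
`δ_mRBA(φ₁, 0)`. -/

variable {k : Type*} [Field k] [CharZero k]
variable {A : Type*} [NonUnitalRing A] [Module k A] [SMulCommClass k A A] [IsScalarTower k A A]

theorem stmt14 (kappa : k) (R : A →ₗ[k] A)
    (hR : ∀ a b : A, R a * R b = R (R a * b + a * R b) + kappa • (a * b))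
    (mu mu' : ℕ → A →ₗ[k] A →ₗ[k] A) (Rr Rr' : ℕ → A →ₗ[k] A)
    (hmu0 : ∀ a b : A, mu 0 a b = a * b) (hmu0' : ∀ a b : A, mu' 0 a b = a * b)
    (hR0 : Rr 0 = R) (hR0' : Rr' 0 = R)
    -- `(μᵢ, Rᵢ)` is a formal one-parameter deformation of `(A, R)`
    (hassoc : ∀ (n : ℕ) (a b c : A),
      ∑ i ∈ Finset.range (n + 1), mu i (mu (n - i) a b) c =
        ∑ i ∈ Finset.range (n + 1), mu i a (mu (n - i) b c))
    (hmrb : ∀ (n : ℕ) (a b : A),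
      ∑ i ∈ Finset.range (n + 1), ∑ j ∈ Finset.range (n + 1 - i),
          mu i (Rr j a) (Rr (n - i - j) b) =
        (∑ i ∈ Finset.range (n + 1), ∑ j ∈ Finset.range (n + 1 - i),
            Rr i (mu j (Rr (n - i - j) a) b + mu j a (Rr (n - i - j) b)))
          + kappa • mu n a b)
    -- `(μᵢ', Rᵢ')` is a formal one-parameter deformation of `(A, R)`
    (hassoc' : ∀ (n : ℕ) (a b c : A),
      ∑ i ∈ Finset.range (n + 1), mu' i (mu' (n - i) a b) c =
        ∑ i ∈ Finset.range (n + 1), mu' i a (mu' (n - i) b c))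
    (hmrb' : ∀ (n : ℕ) (a b : A),
      ∑ i ∈ Finset.range (n + 1), ∑ j ∈ Finset.range (n + 1 - i),
          mu' i (Rr' j a) (Rr' (n - i - j) b) =
        (∑ i ∈ Finset.range (n + 1), ∑ j ∈ Finset.range (n + 1 - i),
            Rr' i (mu' j (Rr' (n - i - j) a) b + mu' j a (Rr' (n - i - j) b)))
          + kappa • mu' n a b)
    -- the two deformations are equivalent via `φ_t = Σ φᵢ tⁱ` with `φ₀ = id`
    (phi : ℕ → A →ₗ[k] A) (hphi0 : phi 0 = LinearMap.id)
    (hphimul : ∀ (n : ℕ) (a b : A),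
      ∑ i ∈ Finset.range (n + 1), phi i (mu (n - i) a b) =
        ∑ i ∈ Finset.range (n + 1), ∑ j ∈ Finset.range (n + 1 - i),
          mu' i (phi j a) (phi (n - i - j) b))
    (hphiR : ∀ (n : ℕ) (a : A),
      ∑ i ∈ Finset.range (n + 1), phi i (Rr (n - i) a) =
        ∑ i ∈ Finset.range (n + 1), Rr' i (phi (n - i) a)) :
    (∀ a b : A, mu 1 a b - mu' 1 a b = phi 1 a * b + a * phi 1 b - phi 1 (a * b)) ∧
    (∀ a : A, Rr 1 a - Rr' 1 a = R (phi 1 a) - phi 1 (R a)) := by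
  constructor
  · intro a b
    have h := hphimul 1 a b
    simp [Finset.sum_range_succ, hphi0, hmu0, hmu0'] at h
    rw [sub_eq_sub_iff_add_eq_add, h]
    abel
  · intro a
    have h := hphiR 1 a
    simp [Finset.sum_range_succ, hphi0, hR0, hR0'] at h
    rw [sub_eq_sub_iff_add_eq_add, h]
end

section
/- Let (A, R) be a modified Rota-Baxter algebra of weight κ over a field k of characteristic 0, and (M, S) a bimodule over it. Let χ : A × A → M be bilinear and Φ : A → M linear, and suppose (χ, Φ) is a 2-cocycle, i.e. for all a, b, c ∈ A: a·χ(b,c) − χ(a·b, c) + χ(a, b·c) − χ(a,b)·c = 0, and R(a)·Φ(b) − S(a·Φ(b)) − Φ(R(a)·b + a·R(b)) + Φ(a)·R(b) − S(Φ(a)·b) + χ(R(a), R(b)) − κ·χ(a,b) − S(χ(R(a), b) + χ(a, R(b))) = 0. Then the multiplication (a,u)·(b,v) = (a·b, a·v + u·b + χ(a,b)) on A ⊕ M is associative, and the linear map R_Φ(a,u) = (R(a), S(u) + Φ(a)) is a modified Rota-Baxter operator of weight κ on the resulting algebra A ⊕_χ M. -/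
/-! STATEMENT 15: A 2-cocycle `(χ, Φ)` of a modified Rota-Baxter algebra `(A, R)` of
weight `κ` with coefficients in a bimodule `(M, S)` yields a modified Rota-Baxter algebra
structure `(A ⊕_χ M, R_Φ)` of weight `κ`. -/

variable {k : Type*} [Field k] [CharZero k]
variable {A : Type*} [NonUnitalRing A] [Module k A] [SMulCommClass k A A] [IsScalarTower k A A]
variable {M : Type*} [AddCommGroup M] [Module k M]

/-- The multiplication `(a,u)·(b,v) = (a·b, a·v + u·b + χ(a,b))` on `A ⊕ M`. -/
def extMul {k A M : Type*} [Field k] [NonUnitalRing A] [Module k A] [AddCommGroup M] [Module k M]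
    (l : A →ₗ[k] M →ₗ[k] M) (r : M →ₗ[k] A →ₗ[k] M)
    (chi : A →ₗ[k] A →ₗ[k] M) (p q : A × M) : A × M :=
  (p.1 * q.1, l p.1 q.2 + r p.2 q.1 + chi p.1 q.1)

/-- The map `R_Φ(a,u) = (R(a), S(u) + Φ(a))` on `A ⊕ M`. -/
def extRB {k A M : Type*} [Field k] [NonUnitalRing A] [Module k A] [AddCommGroup M] [Module k M]
    (R : A →ₗ[k] A) (S : M →ₗ[k] M) (Phi : A →ₗ[k] M) (p : A × M) : A × M :=
  (R p.1, S p.2 + Phi p.1)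

theorem stmt15 (kappa : k) (R : A →ₗ[k] A)
    (hR : ∀ a b : A, R a * R b = R (R a * b + a * R b) + kappa • (a * b))
    (l : A →ₗ[k] M →ₗ[k] M) (r : M →ₗ[k] A →ₗ[k] M)
    (hbl : ∀ (a b : A) (u : M), l (a * b) u = l a (l b u))
    (hblr : ∀ (a : A) (u : M) (b : A), r (l a u) b = l a (r u b))
    (hbr : ∀ (u : M) (a b : A), r (r u a) b = r u (a * b))
    (S : M →ₗ[k] M)
    (hS1 : ∀ (a : A) (u : M), l (R a) (S u) = S (l (R a) u + l a (S u)) + kappa • l a u)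
    (hS2 : ∀ (a : A) (u : M), r (S u) (R a) = S (r (S u) a + r u (R a)) + kappa • r u a)
    (chi : A →ₗ[k] A →ₗ[k] M) (Phi : A →ₗ[k] M)
    -- `(χ, Φ)` is a 2-cocycle
    (hc1 : ∀ a b c : A, l a (chi b c) - chi (a * b) c + chi a (b * c) - r (chi a b) c = 0)
    (hc2 : ∀ a b : A,
      l (R a) (Phi b) - S (l a (Phi b)) - Phi (R a * b + a * R b) + r (Phi a) (R b)
          - S (r (Phi a) b) + chi (R a) (R b) - kappa • chi a b
          - S (chi (R a) b + chi a (R b)) = 0) :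
    (∀ p q t : A × M,
      extMul l r chi (extMul l r chi p q) t = extMul l r chi p (extMul l r chi q t)) ∧
    (∀ p q : A × M,
      extMul l r chi (extRB R S Phi p) (extRB R S Phi q) =
        extRB R S Phi (extMul l r chi (extRB R S Phi p) q + extMul l r chi p (extRB R S Phi q))
          + kappa • extMul l r chi p q) := by
  refine ⟨?_, ?_⟩
  · rintro ⟨a, u⟩ ⟨b, v⟩ ⟨c, w⟩
    refine Prod.ext (mul_assoc a b c) ?_
    have h := hc1 a b c
    simp only [extMul, map_add, LinearMap.add_apply, hbl, hblr, hbr]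
    rw [← sub_eq_zero, ← neg_eq_zero, ← h]
    abel
  · rintro ⟨a, u⟩ ⟨b, v⟩
    refine Prod.ext (hR a b) ?_
    have h := hc2 a b
    simp only [extMul, extRB, Prod.snd_add, Prod.fst_add, Prod.smul_snd, map_add,
      LinearMap.add_apply, smul_add, hS1, hS2] at h ⊢
    rw [← sub_eq_zero, ← h]
    abel
end

section
/- Let (A, R) be a modified Rota-Baxter algebra of weight κ over a field k of characteristic 0 and (M, S) a bimodule over it. Let (E, U) be a modified Rota-Baxter algebra of weight κ fitting into a short exact sequence 0 → (M,S) →ⁱ (E,U) →^π (A,R) → 0, where M carries the trivial (zero) multiplication, i is an injective algebra morphism with U ∘ i = i ∘ S, π is a surjective algebra morphism with R ∘ π = π ∘ U, and ker π = im i. Let s : A → E be a linear section of π (π ∘ s = id_A) inducing the given bimodule structure, i.e. s(a)·_E i(u) = i(a·u) and i(u)·_E s(a) = i(u·a) for all a ∈ A, u ∈ M. Define χ^s : A × A → M and Φ^s : A → M by i(χ^s(a,b)) = s(a)·_E s(b) − s(a·b) and i(Φ^s(a)) = U(s(a)) − s(R(a)). Then (χ^s, Φ^s) is a 2-cocycle: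 for all a, b, c ∈ A, a·χ^s(b,c) − χ^s(a·b, c) + χ^s(a, b·c) − χ^s(a,b)·c = 0, and R(a)·Φ^s(b) − S(a·Φ^s(b)) − Φ^s(R(a)·b + a·R(b)) + Φ^s(a)·R(b) − S(Φ^s(a)·b) + χ^s(R(a), R(b)) − κ·χ^s(a,b) − S(χ^s(R(a), b) + χ^s(a, R(b))) = 0. -/
/-! STATEMENT 16: Given an abelian extension `0 → (M,S) → (E,U) → (A,R) → 0` of a modified
Rota-Baxter algebra `(A, R)` of weight `κ` by a bimodule `(M, S)`, and a section `s` of `π`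
inducing the given bimodule structure, the associated pair `(χ^s, Φ^s)` is a 2-cocycle. -/

variable {k : Type*} [Field k] [CharZero k]
variable {A : Type*} [NonUnitalRing A] [Module k A] [SMulCommClass k A A] [IsScalarTower k A A]
variable {M : Type*} [AddCommGroup M] [Module k M]
variable {E : Type*} [NonUnitalRing E] [Module k E] [SMulCommClass k E E] [IsScalarTower k E E]

theorem stmt16 (kappa : k) (R : A →ₗ[k] A)
    (hR : ∀ a b : A, R a * R b = R (R a * b + a * R b) + kappa • (a * b))
    -- `(M, S)` is a bimodule over `(A, R)`
    (l : A →ₗ[k] M →ₗ[k] M) (r : M →ₗ[k] A →ₗ[k] M)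
    (hbl : ∀ (a b : A) (u : M), l (a * b) u = l a (l b u))
    (hblr : ∀ (a : A) (u : M) (b : A), r (l a u) b = l a (r u b))
    (hbr : ∀ (u : M) (a b : A), r (r u a) b = r u (a * b))
    (S : M →ₗ[k] M)
    (hS1 : ∀ (a : A) (u : M), l (R a) (S u) = S (l (R a) u + l a (S u)) + kappa • l a u)
    (hS2 : ∀ (a : A) (u : M), r (S u) (R a) = S (r (S u) a + r u (R a)) + kappa • r u a)
    -- `(E, U)` is a modified Rota-Baxter algebra of weight `κ`
    (U : E →ₗ[k] E)
    (hU : ∀ x y : E, U x * U y = U (U x * y + x * U y) + kappa • (x * y))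
    -- `i : (M,S) → (E,U)` is an injective morphism (`M` has the trivial multiplication)
    (i : M →ₗ[k] E) (hi_inj : Function.Injective i)
    (hi_mul : ∀ u v : M, i u * i v = 0)
    (hiU : ∀ u : M, U (i u) = i (S u))
    -- `π : (E,U) → (A,R)` is a surjective morphism
    (π : E →ₗ[k] A) (hπ_mul : ∀ x y : E, π (x * y) = π x * π y)
    (hπ_surj : Function.Surjective π)
    (hπU : ∀ x : E, R (π x) = π (U x))
    -- exactness: `ker π = im i`
    (hexact : ∀ x : E, π x = 0 ↔ x ∈ Set.range i)
    -- `s` is a section of `π` inducing the given bimodule structure on `(M, S)`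
    (s : A →ₗ[k] E) (hs : ∀ a : A, π (s a) = a)
    (hsl : ∀ (a : A) (u : M), s a * i u = i (l a u))
    (hsr : ∀ (u : M) (a : A), i u * s a = i (r u a))
    -- the maps `χ^s` and `Φ^s`
    (chi : A → A → M) (Phi : A → M)
    (hchi : ∀ a b : A, i (chi a b) = s a * s b - s (a * b))
    (hPhi : ∀ a : A, i (Phi a) = U (s a) - s (R a)) :
    (∀ a b c : A, l a (chi b c) - chi (a * b) c + chi a (b * c) - r (chi a b) c = 0) ∧
    (∀ a b : A,
      l (R a) (Phi b) - S (l a (Phi b)) - Phi (R a * b + a * R b) + r (Phi a) (R b)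
          - S (r (Phi a) b) + chi (R a) (R b) - kappa • chi a b
          - S (chi (R a) b + chi a (R b)) = 0) := by
  constructor
  · intro a b c
    apply hi_inj
    simp only [map_sub, map_add, map_zero, ← hsl, ← hsr, hchi, mul_sub, sub_mul, mul_assoc]
    abel
  · intro a b
    apply hi_inj
    have hPhi_mul : (U (s a) - s (R a)) * (U (s b) - s (R b)) = 0 := by
      rw [← hPhi, ← hPhi, hi_mul]
    have hsR : s (R a * R b) = s (R (R a * b + a * R b)) + kappa • s (a * b) := by
      rw [hR, map_add, map_smul]
    rw [mul_sub, sub_mul, sub_mul, hU] at hPhi_mul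
    simp only [map_sub, map_add, map_zero, map_smul, ← hiU, ← hsl, ← hsr, hchi, hPhi,
      mul_sub, sub_mul, smul_sub, hsR] at hPhi_mul ⊢
    rw [← neg_eq_zero, ← hPhi_mul]
    abel
end
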